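/- Let n ≥ 1 and let v = (v_1, …, v_n) ∈ ℝ^n satisfy v_i > (6n² + 1)v_{i+1} for all 1 ≤ i < n and v_n > 0. Let B = (B_1, …, B_k) be an ordered set partition of [n] with min(B_1) < min(B_2) < … < min(B_k), and let D = (D_1, …, D_ℓ) be an ordered set partition of [n] for which there exists an index j with B_i = D_i for all i < j and B_j ⊊ D_j. Let p_B ∈ ℝ^n be the point whose i-th coordinate is the average of the coordinates of v over the block of B containing i, and define p_D analogously from D. Then ‖v − p_B‖ < ‖v − p_D‖ in the Euclidean norm. -/

import Mathlib

open Classical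

lemma sum_sq_sub_average {α : Type*} (s : Finset α) (hs : s.Nonempty) (f : α → ℝ) :
    ∑ x ∈ s, (f x - (∑ y ∈ s, f y) / (s.card : ℝ)) ^ 2 =
      ∑ x ∈ s, f x ^ 2 - (∑ y ∈ s, f y) ^ 2 / (s.card : ℝ) := by
  have hc : (s.card : ℝ) ≠ 0 := by exact_mod_cast hs.card_pos.ne'
  set a := (∑ y ∈ s, f y) / (s.card : ℝ) with ha
  have hS : ∑ y ∈ s, f y = a * s.card := by rw [ha]; field_simp
  have h : ∀ x ∈ s, (f x - a) ^ 2 = f x ^ 2 - 2 * a * f x + a ^ 2 := fun x _ => by ring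
  rw [Finset.sum_congr rfl h, Finset.sum_add_distrib, Finset.sum_sub_distrib,
    ← Finset.mul_sum, hS, Finset.sum_const, nsmul_eq_mul]
  field_simp
  ring

lemma average_mem_Icc {α : Type*} (s : Finset α) (hs : s.Nonempty) (f : α → ℝ) {l u : ℝ}
    (h : ∀ x ∈ s, f x ∈ Set.Icc l u) : (∑ x ∈ s, f x) / (s.card : ℝ) ∈ Set.Icc l u := by
  have hc : (0 : ℝ) < s.card := by exact_mod_cast hs.card_pos
  constructor
  · rw [le_div_iff₀ hc]
    have := s.card_nsmul_le_sum f l fun x hx => (h x hx).1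
    rw [nsmul_eq_mul] at this
    linarith
  · rw [div_le_iff₀ hc]
    have := s.sum_le_card_nsmul f u fun x hx => (h x hx).2
    rw [nsmul_eq_mul] at this
    linarith

lemma pos_of_rapidly_decreasing {n : ℕ} (hn : 1 ≤ n) {K : ℝ} (hK : 1 ≤ K) (v : Fin n → ℝ)
    (hv : ∀ i : ℕ, ∀ h : i + 1 < n, K * v ⟨i + 1, h⟩ < v ⟨i, Nat.lt_of_succ_lt h⟩)
    (hvn : 0 < v ⟨n - 1, Nat.sub_lt hn one_pos⟩) (x : Fin n) : 0 < v x := by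
  obtain ⟨i, hi⟩ := x
  have hle : i ≤ n - 1 := by omega
  induction hle using Nat.decreasingInduction with
  | self => exact hvn
  | of_succ i h ih =>
    have := ih (by omega)
    have := hv i (by omega)
    nlinarith

lemma mul_lt_of_rapidly_decreasing {n : ℕ} {K : ℝ} (hK : 1 ≤ K) (v : Fin n → ℝ)
    (hv : ∀ i : ℕ, ∀ h : i + 1 < n, K * v ⟨i + 1, h⟩ < v ⟨i, Nat.lt_of_succ_lt h⟩)
    (hpos : ∀ x, 0 < v x) {x y : Fin n} (hxy : x < y) : K * v y < v x := by
  obtain ⟨a, ha⟩ := x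
  obtain ⟨b, hb⟩ := y
  have hab : a + 1 ≤ b := hxy
  clear hxy
  induction b, hab using Nat.le_induction with
  | base => exact hv a hb
  | succ b h ih =>
    have h1 := ih (by omega)
    have h2 := hv b hb
    have h3 := hpos ⟨b, by omega⟩
    nlinarith

/-- A block of size `b` with sum at least `K * e` beats a larger block of size `d` with sum at
most `K * e + n * e`. -/
lemma gap_of_card_lt {n b d K e : ℝ} (hb : 1 ≤ b) (hbd : b + 1 ≤ d) (hdn : d ≤ n)
    (hK : K = 6 * n ^ 2 + 1) (he : 0 < e) :
    n * e ^ 2 + (K * e + n * e) ^ 2 / d < (K * e) ^ 2 / b := by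
  have hb0 : 0 < b := by linarith
  have hd0 : 0 < d := by linarith
  have hn : 1 ≤ n := by linarith
  have hK0 : 0 < K := by rw [hK]; positivity
  have hnK : n ≤ K := by nlinarith
  have key : n * b * d + b * (K + n) ^ 2 < d * K ^ 2 := by
    have h1 : b * d ≤ n * n := mul_le_mul (by linarith) hdn hd0.le (by linarith)
    have h2 : n * (b * d) ≤ n * (n * n) := mul_le_mul_of_nonneg_left h1 (by linarith)
    have h3 : b * (2 * K * n + n ^ 2) ≤ n * (2 * K * n + n ^ 2) :=
      mul_le_mul_of_nonneg_right (by linarith) (by positivity)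
    have h4 : K ^ 2 ≤ (d - b) * K ^ 2 := le_mul_of_one_le_left (by positivity) (by linarith)
    have h5 : n ^ 2 * n ≤ n ^ 2 * K := mul_le_mul_of_nonneg_left hnK (by positivity)
    have h6 : K ^ 2 = 6 * (n ^ 2 * K) + K := by rw [sq]; nth_rewrite 1 [hK]; ring
    have h7 : 0 < n ^ 2 * K := by positivity
    nlinarith
  have : (K * e) ^ 2 / b - (n * e ^ 2 + (K * e + n * e) ^ 2 / d) =
      e ^ 2 * (d * K ^ 2 - (n * b * d + b * (K + n) ^ 2)) / (b * d) := by
    field_simp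
  have h : 0 < e ^ 2 * (d * K ^ 2 - (n * b * d + b * (K + n) ^ 2)) / (b * d) := by
    have := sub_pos.2 key
    positivity
  linarith

/-- for generic `v` (Equation vec2), if `B = (B₁,…,B_k)` is an ordered set
partition of `[n]` with increasing block minima and `D = (D₁,…,D_ℓ)` is an ordered set
partition agreeing with `B` before index `j` and with `B_j ⊊ D_j`, then the block-average
point `p_B` is strictly closer to `v` than `p_D`. -/
theorem block_average_closer {n : ℕ} (hn : 1 ≤ n)
    (v : EuclideanSpace ℝ (Fin n))
    (hv : ∀ i : ℕ, ∀ h : i + 1 < n, (6 * (n : ℝ) ^ 2 + 1) * v ⟨i + 1, h⟩ < v ⟨i, by omega⟩)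
    (hvn : 0 < v ⟨n - 1, by omega⟩)
    (k : ℕ) (B : ℕ → Finset (Fin n))
    (hBne : ∀ i < k, (B i).Nonempty)
    (hBdisj : ∀ i < k, ∀ j < k, i ≠ j → Disjoint (B i) (B j))
    (hBcover : ∀ x : Fin n, ∃ i < k, x ∈ B i)
    (hBmin : ∀ (i j : ℕ) (hi : i < k) (hj : j < k), i < j →
      (B i).min' (hBne i hi) < (B j).min' (hBne j hj))
    (ℓ : ℕ) (D : ℕ → Finset (Fin n))
    (hDne : ∀ i < ℓ, (D i).Nonempty)
    (hDdisj : ∀ i < ℓ, ∀ j < ℓ, i ≠ j → Disjoint (D i) (D j))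
    (hDcover : ∀ x : Fin n, ∃ i < ℓ, x ∈ D i)
    (j : ℕ) (hjk : j < k) (hjl : j < ℓ)
    (hagree : ∀ i < j, B i = D i) (hss : B j ⊂ D j)
    (pB pD : EuclideanSpace ℝ (Fin n))
    (hpB : ∀ (i : Fin n) (a : ℕ), a < k → i ∈ B a →
      pB i = (∑ m ∈ B a, v m) / ((B a).card : ℝ))
    (hpD : ∀ (i : Fin n) (a : ℕ), a < ℓ → i ∈ D a →
      pD i = (∑ m ∈ D a, v m) / ((D a).card : ℝ)) :
    dist v pB < dist v pD := by
  have hK1 : (1 : ℝ) ≤ 6 * (n : ℝ) ^ 2 + 1 := by nlinarith [sq_nonneg (n : ℝ)]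
  set K : ℝ := 6 * (n : ℝ) ^ 2 + 1 with hK
  have hK0 : 0 < K := by linarith
  have hpos : ∀ x, 0 < v x := pos_of_rapidly_decreasing hn hK1 v hv hvn
  set m := (B j).min' (hBne j hjk) with hm
  have hmB : m ∈ B j := Finset.min'_mem _ _
  have hmD : m ∈ D j := hss.1 hmB
  set e := v m / K with he
  have he0 : 0 < e := div_pos (hpos m) hK0
  have hKe : v m = K * e := by rw [he]; field_simp
  have hcardn : ∀ s : Finset (Fin n), (s.card : ℝ) ≤ n := fun s =>
    Nat.cast_le.2 (card_finset_fin_le s)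
  -- the union of the blocks shared by `B` and `D`
  set C : Finset (Fin n) := Finset.univ.filter fun x => ∃ i < j, x ∈ B i with hC
  have hnotC : ∀ a, j ≤ a → a < k → ∀ x ∈ B a, x ∉ C := by
    intro a hja ha x hx hxC
    obtain ⟨i, hi, hxi⟩ := (Finset.mem_filter.1 hxC).2
    exact Finset.disjoint_left.1 (hBdisj i (by omega) a ha (by omega)) hxi hx
  have hDC : D j ⊆ Cᶜ := by
    intro x hx
    rw [Finset.mem_compl]
    intro hxC
    obtain ⟨i, hi, hxi⟩ := (Finset.mem_filter.1 hxC).2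
    rw [hagree i hi] at hxi
    exact Finset.disjoint_left.1 (hDdisj i (by omega) j hjl (by omega)) hxi hx
  have hsmall : ∀ x, x ∉ C → x ≠ m → v x ∈ Set.Icc 0 e := by
    intro x hxC hxm
    refine ⟨(hpos x).le, ?_⟩
    obtain ⟨a, ha, hxa⟩ := hBcover x
    have hja : j ≤ a := by
      by_contra! h
      exact hxC (Finset.mem_filter.2 ⟨Finset.mem_univ _, a, h, hxa⟩)
    have hmx : m ≤ x := by
      have hax : (B a).min' (hBne a ha) ≤ x := Finset.min'_le _ _ hxa
      rcases hja.eq_or_lt with rfl | hlt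
      · exact hax
      · exact (hBmin j a hjk ha hlt).le.trans hax
    rw [he, le_div_iff₀ hK0, mul_comm]
    exact (mul_lt_of_rapidly_decreasing hK1 v hv hpos (lt_of_le_of_ne hmx hxm.symm)).le
  have hsq : ∀ y ∈ Set.Icc 0 e, y ^ 2 ≤ e ^ 2 := fun y hy => pow_le_pow_left₀ hy.1 hy.2 2
  have hcommon : ∑ x ∈ C, (v x - pB x) ^ 2 = ∑ x ∈ C, (v x - pD x) ^ 2 := by
    refine Finset.sum_congr rfl fun x hx => ?_
    obtain ⟨i, hi, hxi⟩ := (Finset.mem_filter.1 hx).2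
    rw [hpB x i (by omega) hxi, hpD x i (by omega) (hagree i hi ▸ hxi), hagree i hi]
  have hBC : B j ⊆ Cᶜ := hss.1.trans hDC
  have hrest : ∑ x ∈ Cᶜ \ B j, (v x - pB x) ^ 2 ≤ ((Cᶜ \ B j).card : ℝ) * e ^ 2 := by
    rw [← nsmul_eq_mul]
    refine Finset.sum_le_card_nsmul _ _ _ fun x hx => ?_
    obtain ⟨hxC, hxB⟩ := Finset.mem_sdiff.1 hx
    rw [Finset.mem_compl] at hxC
    have h1 := hsmall x hxC fun h => hxB (h ▸ hmB)
    obtain ⟨a, ha, hxa⟩ := hBcover x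
    have haj : a ≠ j := fun h => hxB (h ▸ hxa)
    have hja : j ≤ a := by
      by_contra! h
      exact hxC (Finset.mem_filter.2 ⟨Finset.mem_univ _, a, h, hxa⟩)
    have h2 : pB x ∈ Set.Icc 0 e := by
      rw [hpB x a ha hxa]
      refine average_mem_Icc _ (hBne a ha) _ fun y hy => hsmall y (hnotC a hja ha y hy) ?_
      rintro rfl
      exact Finset.disjoint_left.1 (hBdisj a ha j hjk haj) hy hmB
    exact sq_le_sq' (by linarith [h1.1, h2.2]) (by linarith [h1.2, h2.1])
  have hblockB : ∑ x ∈ B j, (v x - pB x) ^ 2 ≤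
      v m ^ 2 + ((B j).card : ℝ) * e ^ 2 - v m ^ 2 / ((B j).card : ℝ) := by
    rw [Finset.sum_congr rfl fun x hx => by rw [hpB x j hjk hx],
      sum_sq_sub_average _ ⟨m, hmB⟩]
    have h1 : v m ≤ ∑ x ∈ B j, v x :=
      Finset.single_le_sum (f := fun x => v x) (fun x _ => (hpos x).le) hmB
    have h2 : v m ^ 2 / ((B j).card : ℝ) ≤ (∑ x ∈ B j, v x) ^ 2 / ((B j).card : ℝ) :=
      div_le_div_of_nonneg_right (pow_le_pow_left₀ (hpos m).le h1 2) (Nat.cast_nonneg _)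
    have h3 : ∑ x ∈ (B j).erase m, v x ^ 2 ≤ ((B j).card : ℝ) * e ^ 2 := by
      refine (Finset.sum_le_card_nsmul _ _ (e ^ 2) fun x hx => ?_).trans ?_
      · obtain ⟨hxm, hxB⟩ := Finset.mem_erase.1 hx
        exact hsq _ (hsmall x (hnotC j le_rfl hjk x hxB) hxm)
      · rw [nsmul_eq_mul]
        gcongr
        exact Finset.erase_subset _ _
    rw [← Finset.add_sum_erase _ _ hmB]
    linarith
  have hblockD : v m ^ 2 - (K * e + n * e) ^ 2 / ((D j).card : ℝ) ≤
      ∑ x ∈ D j, (v x - pD x) ^ 2 := by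
    rw [Finset.sum_congr rfl fun x hx => by rw [hpD x j hjl hx],
      sum_sq_sub_average _ ⟨m, hmD⟩]
    have h1 : v m ^ 2 ≤ ∑ x ∈ D j, v x ^ 2 :=
      Finset.single_le_sum (f := fun x => v x ^ 2) (fun x _ => sq_nonneg _) hmD
    have h0 : 0 ≤ ∑ x ∈ D j, v x := Finset.sum_nonneg fun x _ => (hpos x).le
    have h3 : ∑ x ∈ (D j).erase m, v x ≤ n * e := by
      refine (Finset.sum_le_card_nsmul _ _ e fun x hx => ?_).trans ?_
      · obtain ⟨hxm, hxD⟩ := Finset.mem_erase.1 hx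
        exact (hsmall x (Finset.mem_compl.1 (hDC hxD)) hxm).2
      · rw [nsmul_eq_mul]
        exact mul_le_mul_of_nonneg_right (hcardn _) he0.le
    have h2 : ∑ x ∈ D j, v x ≤ K * e + n * e := by
      rw [← Finset.add_sum_erase _ _ hmD]
      linarith
    have h4 : (∑ x ∈ D j, v x) ^ 2 / ((D j).card : ℝ) ≤
        (K * e + n * e) ^ 2 / ((D j).card : ℝ) :=
      div_le_div_of_nonneg_right (pow_le_pow_left₀ h0 h2 2) (Nat.cast_nonneg _)
    linarith
  have hgap := gap_of_card_lt (n := n) (b := (B j).card) (d := (D j).card) (K := K) (e := e)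
    (by exact_mod_cast Finset.card_pos.2 ⟨m, hmB⟩) (by exact_mod_cast Finset.card_lt_card hss)
    (hcardn _) hK he0
  have hcard : ((Cᶜ \ B j).card : ℝ) + ((B j).card : ℝ) ≤ n := by
    rw [← Nat.cast_add, Finset.card_sdiff_add_card_eq_card hBC]
    exact hcardn _
  have hcard' := mul_le_mul_of_nonneg_right hcard (sq_nonneg e)
  have hsub : ∑ x ∈ D j, (v x - pD x) ^ 2 ≤ ∑ x ∈ Cᶜ, (v x - pD x) ^ 2 :=
    Finset.sum_le_sum_of_subset_of_nonneg hDC fun x _ _ => sq_nonneg _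
  rw [EuclideanSpace.dist_eq, EuclideanSpace.dist_eq]
  refine Real.sqrt_lt_sqrt (Finset.sum_nonneg fun x _ => sq_nonneg _) ?_
  simp only [Real.dist_eq, sq_abs]
  rw [← Finset.sum_add_sum_compl C, ← Finset.sum_add_sum_compl C, hcommon,
    ← Finset.sum_sdiff hBC]
  rw [← hKe] at hgap hblockD
  linarith
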